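/- Let n ≥ m ≥ 1, let H be a real symmetric n×n matrix with spectral norm ‖H‖ ≤ h, and let A be a real n×m matrix with ‖Av‖ ≥ σ‖v‖ for all v ∈ ℝᵐ, where σ > 0. Let R := A(AᵀA)⁻¹Aᵀ be the orthogonal projection onto the column space of A and P := I − R. Suppose β > 0 satisfies dᵀH d ≥ β‖d‖² for every d ∈ ℝⁿ with Aᵀd = 0, and let ρ > 0 satisfy 2ρσ² ≥ h + β. Then for every d ∈ ℝⁿ, dᵀ(P H P − R H R + 2ρ·A·Aᵀ)·d ≥ β‖d‖². -/

import Mathlib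

open Matrix
open scoped RealInnerProductSpace

/-- Spectral (ℓ²-operator) norm of a real rectangular matrix. -/
noncomputable def spec {n m : ℕ} (A : Matrix (Fin n) (Fin m) ℝ) : ℝ :=
  ‖LinearMap.toContinuousLinearMap (Matrix.toEuclideanLin A)‖

theorem Matrix.toEuclideanLin_mul_apply {m n k : ℕ} (M : Matrix (Fin m) (Fin n) ℝ)
    (N : Matrix (Fin n) (Fin k) ℝ) (x : EuclideanSpace ℝ (Fin k)) :
    toEuclideanLin (M * N) x = toEuclideanLin M (toEuclideanLin N x) := by
  simp [toLpLin_apply]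

theorem Matrix.inner_toEuclideanLin_right {m n : ℕ} (M : Matrix (Fin m) (Fin n) ℝ)
    (x : EuclideanSpace ℝ (Fin m)) (y : EuclideanSpace ℝ (Fin n)) :
    ⟪x, toEuclideanLin M y⟫ = ⟪toEuclideanLin Mᵀ x, y⟫ := by
  rw [← conjTranspose_eq_transpose_of_trivial, toEuclideanLin_conjTranspose_eq_adjoint,
    LinearMap.adjoint_inner_left]

theorem Matrix.isUnit_det_transpose_mul_self {m n : ℕ} (A : Matrix (Fin n) (Fin m) ℝ)
    (hA : ∀ v : EuclideanSpace ℝ (Fin m), toEuclideanLin A v = 0 → v = 0) :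
    IsUnit (Aᵀ * A).det := by
  rw [← isUnit_iff_isUnit_det, ← mulVec_injective_iff_isUnit]
  refine (injective_iff_map_eq_zero (Aᵀ * A).mulVecLin).2 fun v hv => ?_
  have hzero : toEuclideanLin (Aᵀ * A) (WithLp.toLp 2 v) = 0 := by
    rw [mulVecLin_apply] at hv
    simp only [toLpLin_apply, hv, WithLp.toLp_zero]
  have hAv : toEuclideanLin A (WithLp.toLp 2 v) = 0 := by
    rw [← inner_self_eq_zero (𝕜 := ℝ), inner_toEuclideanLin_right, ← toEuclideanLin_mul_apply,
      hzero, inner_zero_left]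
  simpa using hA _ hAv

theorem inner_toEuclideanLin_self_le_spec {n : ℕ} (H : Matrix (Fin n) (Fin n) ℝ)
    (x : EuclideanSpace ℝ (Fin n)) :
    ⟪x, Matrix.toEuclideanLin H x⟫ ≤ spec H * ‖x‖ ^ 2 := by
  have hle : ‖Matrix.toEuclideanLin H x‖ ≤ spec H * ‖x‖ :=
    (LinearMap.toContinuousLinearMap (Matrix.toEuclideanLin H)).le_opNorm x
  calc ⟪x, Matrix.toEuclideanLin H x⟫ ≤ ‖x‖ * ‖Matrix.toEuclideanLin H x‖ :=
        real_inner_le_norm _ _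
    _ ≤ ‖x‖ * (spec H * ‖x‖) := by gcongr
    _ = spec H * ‖x‖ ^ 2 := by ring

/-- **Positive definiteness of the Hessian of Fletcher's augmented Lagrangian at a
feasible point** (exact, zero-residual core of the paper's lemma).  With `H` symmetric,
`‖H‖ ≤ h`, `A` of smallest singular value at least `σ > 0`, `R = A(AᵀA)⁻¹Aᵀ`,
`P = I − R`, `dᵀHd ≥ β‖d‖²` for all `d` with `Aᵀd = 0`, and `ρ > 0` with
`2ρσ² ≥ h + β`, one has `dᵀ(PHP − RHR + 2ρAAᵀ)d ≥ β‖d‖²` for all `d`. -/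
theorem fletcher_hessian_positive_definite
    {n m : ℕ} (hm : 1 ≤ m) (hmn : m ≤ n)
    (H : Matrix (Fin n) (Fin n) ℝ) (hHsymm : H.IsSymm)
    (h : ℝ) (hHnorm : spec H ≤ h)
    (A : Matrix (Fin n) (Fin m) ℝ) (σ : ℝ) (hσ : 0 < σ)
    (hA : ∀ v : EuclideanSpace ℝ (Fin m), σ * ‖v‖ ≤ ‖Matrix.toEuclideanLin A v‖)
    (R P : Matrix (Fin n) (Fin n) ℝ)
    (hR : R = A * ((Aᵀ * A)⁻¹ * Aᵀ)) (hP : P = 1 - R)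
    (β : ℝ) (hβ : 0 < β)
    (hquad : ∀ d : EuclideanSpace ℝ (Fin n), Matrix.toEuclideanLin Aᵀ d = 0 →
      β * ‖d‖ ^ 2 ≤ ⟪d, Matrix.toEuclideanLin H d⟫)
    (ρ : ℝ) (hρ : 0 < ρ) (hρ2 : h + β ≤ 2 * ρ * σ ^ 2) :
    ∀ d : EuclideanSpace ℝ (Fin n),
      β * ‖d‖ ^ 2 ≤
        ⟪d, Matrix.toEuclideanLin (P * H * P - R * H * R + (2 * ρ) • (A * Aᵀ)) d⟫ := by
  intro d
  have hunit : IsUnit (Aᵀ * A).det := by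
    refine isUnit_det_transpose_mul_self A fun v hv => ?_
    have hv' := hA v
    rw [hv, norm_zero] at hv'
    exact norm_le_zero_iff.1 (nonpos_of_mul_nonpos_right hv' hσ)
  have hRT : Rᵀ = R := by
    rw [hR]
    simp [transpose_mul, transpose_nonsing_inv, Matrix.mul_assoc]
  have hPT : Pᵀ = P := by rw [hP, transpose_sub, transpose_one, hRT]
  have hAR : Aᵀ * R = Aᵀ := by
    rw [hR, ← Matrix.mul_assoc, ← Matrix.mul_assoc, mul_nonsing_inv _ hunit, Matrix.one_mul]
  have hAP : Aᵀ * P = 0 := by rw [hP, Matrix.mul_sub, hAR, Matrix.mul_one, sub_self]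
  obtain ⟨v, hv⟩ : ∃ v, toEuclideanLin R d = toEuclideanLin A v :=
    ⟨_, by rw [hR, toEuclideanLin_mul_apply]⟩
  have hAy : toEuclideanLin Aᵀ (toEuclideanLin R d) = toEuclideanLin Aᵀ d := by
    rw [← toEuclideanLin_mul_apply, hAR]
  have hAw : toEuclideanLin Aᵀ (toEuclideanLin P d) = 0 := by
    rw [← toEuclideanLin_mul_apply, hAP, map_zero, LinearMap.zero_apply]
  have hd : d = toEuclideanLin P d + toEuclideanLin R d := by
    rw [hP, map_sub, LinearMap.sub_apply, sub_add_cancel]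
    simp
  have hexp : ⟪d, toEuclideanLin (P * H * P - R * H * R + (2 * ρ) • (A * Aᵀ)) d⟫ =
      ⟪toEuclideanLin P d, toEuclideanLin H (toEuclideanLin P d)⟫
        - ⟪toEuclideanLin R d, toEuclideanLin H (toEuclideanLin R d)⟫
        + 2 * ρ * ‖toEuclideanLin Aᵀ d‖ ^ 2 := by
    rw [map_add, map_sub, map_smul, LinearMap.add_apply, LinearMap.sub_apply,
      LinearMap.smul_apply, inner_add_right, inner_sub_right, real_inner_smul_right]
    simp only [Matrix.mul_assoc, toEuclideanLin_mul_apply]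
    rw [inner_toEuclideanLin_right P, inner_toEuclideanLin_right R,
      inner_toEuclideanLin_right A, hPT, hRT, real_inner_self_eq_norm_sq]
  have hw := hquad _ hAw
  have horth : ⟪toEuclideanLin P d, toEuclideanLin R d⟫ = 0 := by
    rw [hv, inner_toEuclideanLin_right, hAw, inner_zero_left]
  have hpyth : ‖d‖ ^ 2 = ‖toEuclideanLin P d‖ ^ 2 + ‖toEuclideanLin R d‖ ^ 2 := by
    conv_lhs => rw [hd]
    rw [norm_add_sq_real, horth]
    ring
  have hy : ‖toEuclideanLin R d‖ ^ 2 ≤ ‖toEuclideanLin Aᵀ d‖ * ‖v‖ := by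
    rw [← real_inner_self_eq_norm_sq]
    nth_rewrite 2 [hv]
    rw [inner_toEuclideanLin_right, hAy]
    exact real_inner_le_norm _ _
  have hlow : σ * ‖toEuclideanLin R d‖ ≤ ‖toEuclideanLin Aᵀ d‖ := by
    rcases (norm_nonneg (toEuclideanLin R d)).eq_or_lt with h0 | h0
    · rw [← h0, mul_zero]
      exact norm_nonneg _
    · have hσv := hA v
      rw [← hv] at hσv
      refine le_of_mul_le_mul_right ?_ h0
      calc σ * ‖toEuclideanLin R d‖ * ‖toEuclideanLin R d‖
          = σ * ‖toEuclideanLin R d‖ ^ 2 := by ring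
        _ ≤ σ * (‖toEuclideanLin Aᵀ d‖ * ‖v‖) := by gcongr
        _ = ‖toEuclideanLin Aᵀ d‖ * (σ * ‖v‖) := by ring
        _ ≤ ‖toEuclideanLin Aᵀ d‖ * ‖toEuclideanLin R d‖ := by gcongr
  have hHy : ⟪toEuclideanLin R d, toEuclideanLin H (toEuclideanLin R d)⟫
      ≤ h * ‖toEuclideanLin R d‖ ^ 2 :=
    (inner_toEuclideanLin_self_le_spec H _).trans (by gcongr)
  have hpen : (h + β) * ‖toEuclideanLin R d‖ ^ 2 ≤ 2 * ρ * ‖toEuclideanLin Aᵀ d‖ ^ 2 :=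
    calc (h + β) * ‖toEuclideanLin R d‖ ^ 2
        ≤ 2 * ρ * σ ^ 2 * ‖toEuclideanLin R d‖ ^ 2 := by gcongr
      _ = 2 * ρ * (σ * ‖toEuclideanLin R d‖) ^ 2 := by ring
      _ ≤ 2 * ρ * ‖toEuclideanLin Aᵀ d‖ ^ 2 := by gcongr
  rw [hexp, hpyth]
  linarith
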